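/- arXiv:2002.00178 — 3 statements merged into one kernel-verified Lean document; each statement's English description precedes it below -/
import Mathlib

section
/- Let m ≥ 1 and let α = α₁ ⊗ ⋯ ⊗ α_m and β̃ = β̃₁ ⊗ ⋯ ⊗ β̃_m be product probability measures on ℝ^m with β̃ ≪ α, and let h = dβ̃/dα. Let W = W₁ × ⋯ × W_m with each W_j ⊆ ℝ measurable and β̃(W) > 0, and let β denote the normalized restriction of β̃ to W, i.e. β(S) = β̃(S ∩ W)/β̃(W). Let f : ℝ^m → [0,∞] be measurable, let n ≥ 1, ε > 0 and C₁, C₂, C₃ ≥ 0. Assume: (i) f(w) ≤ C₁ n ε² for all w ∈ W; (ii) ln h(w) ≤ C₂ n ε² for β̃-almost every w ∈ W; (iii) −∑_{j=1}^m ln β̃_j(W_j) ≤ C₃ n ε². Then (1/n) ∫ f dβ + (1/n) KL(β ‖ α) ≤ (C₁ + C₂ + C₃) ε². -/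
open MeasureTheory Real
open scoped ENNReal

/-- Kullback–Leibler divergence `KL(β‖ν) = ∫ ln(dβ/dν) dβ`. -/
noncomputable def klDiv {Ω : Type*} [MeasurableSpace Ω] (β ν : Measure Ω) : ℝ :=
  ∫ x, Real.log (β.rnDeriv ν x).toReal ∂β

/-- Variational-inference oracle inequality: for product probability measures
`β̃ = ⊗ β̃_j ≪ α = ⊗ α_j` on `ℝ^m`, `h = dβ̃/dα`, a product set `W = ∏ W_j` with
`β̃(W) > 0`, and `β` the normalized restriction of `β̃` to `W`, if
(i) `f ≤ C₁ n ε²` on `W`, (ii) `ln h ≤ C₂ n ε²` β̃-a.e. on `W`, and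
(iii) `−∑ ln β̃_j(W_j) ≤ C₃ n ε²`, then
`(1/n) ∫ f dβ + (1/n) KL(β‖α) ≤ (C₁ + C₂ + C₃) ε²`. -/
theorem stmt4 (m : ℕ) (hm : 1 ≤ m)
    (αs βs : Fin m → Measure ℝ)
    (hαs : ∀ j, IsProbabilityMeasure (αs j)) (hβs : ∀ j, IsProbabilityMeasure (βs j))
    (hac : Measure.pi βs ≪ Measure.pi αs)
    (Ws : Fin m → Set ℝ) (hWs : ∀ j, MeasurableSet (Ws j))
    (hWpos : 0 < Measure.pi βs (Set.univ.pi Ws))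
    (f : (Fin m → ℝ) → ℝ≥0∞) (hf : Measurable f)
    (n : ℕ) (hn : 1 ≤ n) (ε : ℝ) (hε : 0 < ε)
    (C₁ C₂ C₃ : ℝ) (hC₁ : 0 ≤ C₁) (hC₂ : 0 ≤ C₂) (hC₃ : 0 ≤ C₃)
    (h1 : ∀ w ∈ Set.univ.pi Ws, f w ≤ ENNReal.ofReal (C₁ * n * ε ^ 2))
    (h2 : ∀ᵐ w ∂(Measure.pi βs), w ∈ Set.univ.pi Ws →
      Real.log ((Measure.pi βs).rnDeriv (Measure.pi αs) w).toReal ≤ C₂ * n * ε ^ 2)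
    (h3 : -(∑ j, Real.log ((βs j) (Ws j)).toReal) ≤ C₃ * n * ε ^ 2) :
    (1 / (n : ℝ)) *
        (∫⁻ w, f w ∂((Measure.pi βs (Set.univ.pi Ws))⁻¹ •
          (Measure.pi βs).restrict (Set.univ.pi Ws))).toReal
      + (1 / (n : ℝ)) *
        klDiv ((Measure.pi βs (Set.univ.pi Ws))⁻¹ •
          (Measure.pi βs).restrict (Set.univ.pi Ws)) (Measure.pi αs)
      ≤ (C₁ + C₂ + C₃) * ε ^ 2 := by
  have hnpos : (0 : ℝ) < n := by exact_mod_cast hn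
  have hpi : Measure.pi βs (Set.univ.pi Ws) = ∏ j, βs j (Ws j) := Measure.pi_pi βs Ws
  have hWm : MeasurableSet (Set.univ.pi Ws) := MeasurableSet.univ_pi hWs
  set B := Measure.pi βs with hB
  set A := Measure.pi αs with hA
  set W := Set.univ.pi Ws with hW
  have hBW : B W ≠ 0 := hWpos.ne'
  have hBWt : B W ≠ ∞ := measure_ne_top _ _
  have hc0 : (B W)⁻¹ ≠ 0 := ENNReal.inv_ne_zero.2 hBWt
  have hct : (B W)⁻¹ ≠ ∞ := ENNReal.inv_ne_top.2 hBW
  set β := (B W)⁻¹ • B.restrict W with hβ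
  have hprob : IsProbabilityMeasure β := by
    constructor
    simp [hβ, ENNReal.inv_mul_cancel hBW hBWt]
  have hres : β ≪ B.restrict W := Measure.smul_absolutelyContinuous
  have hβB : β ≪ B := hres.trans Measure.absolutelyContinuous_restrict |>.trans
    Measure.AbsolutelyContinuous.rfl
  have hmem : ∀ᵐ w ∂β, w ∈ W := hres.ae_le (ae_restrict_mem hWm)
  have hlog : Real.log (B W)⁻¹.toReal ≤ C₃ * n * ε ^ 2 := by
    refine le_trans (le_of_eq ?_) h3
    rw [ENNReal.toReal_inv, Real.log_inv, hpi, ENNReal.toReal_prod, Real.log_prod]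
    intro j _ hj
    apply hBW
    rw [hpi]
    refine Finset.prod_eq_zero (Finset.mem_univ j) ?_
    rcases (ENNReal.toReal_eq_zero_iff _).1 hj with h | h
    · exact h
    · exact absurd h (measure_ne_top _ _)
  have hd : ∀ᵐ w ∂β, β.rnDeriv A w = (B W)⁻¹ * B.rnDeriv A w := by
    have e1 := (hβB.trans hac).ae_le (Measure.rnDeriv_smul_left_of_ne_top (B.restrict W) A hct)
    have e2 := (hβB.trans hac).ae_le (Measure.rnDeriv_restrict B A hWm)
    filter_upwards [e1, e2, hmem] with w h1 h2 h3
    rw [h1, Pi.smul_apply, h2, Set.indicator_of_mem h3, smul_eq_mul]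
  have hbd : ∀ᵐ w ∂β, Real.log (β.rnDeriv A w).toReal ≤ (C₃ + C₂) * n * ε ^ 2 := by
    have e1 := hβB.ae_le (Measure.rnDeriv_pos hac)
    have e2 := (hβB.trans hac).ae_le (Measure.rnDeriv_lt_top B A)
    filter_upwards [hd, e1, e2, hmem, hβB.ae_le h2] with w h1 h2 h3 h4 h5
    rw [h1, ENNReal.toReal_mul, Real.log_mul (ENNReal.toReal_ne_zero.2 ⟨hc0, hct⟩)
      (ENNReal.toReal_ne_zero.2 ⟨h2.ne', h3.ne⟩)]
    linarith [h5 h4]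
  have hkl : klDiv β A ≤ (C₃ + C₂) * n * ε ^ 2 := by
    unfold klDiv
    by_cases hi : Integrable (fun x => Real.log (β.rnDeriv A x).toReal) β
    · refine (integral_mono_ae hi (integrable_const _) hbd).trans ?_
      simp
    · rw [integral_undef hi]
      positivity
  have hfb : (∫⁻ w, f w ∂β).toReal ≤ C₁ * n * ε ^ 2 := by
    refine ENNReal.toReal_le_of_le_ofReal (by positivity) ?_
    calc ∫⁻ w, f w ∂β ≤ ∫⁻ _, ENNReal.ofReal (C₁ * n * ε ^ 2) ∂β :=
          lintegral_mono_ae (hmem.mono h1)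
      _ = _ := by simp
  calc _ = (1 / (n : ℝ)) * ((∫⁻ w, f w ∂β).toReal + klDiv β A) := by ring
    _ ≤ (1 / (n : ℝ)) * (C₁ * n * ε ^ 2 + (C₃ + C₂) * n * ε ^ 2) := by gcongr
    _ = _ := by field_simp; ring
end

section
/- Let α be a σ-finite measure and β̃ a probability measure on a measurable space, with β̃ ≪ α and density h = dβ̃/dα. Let W be a measurable set with β̃(W) > 0, and let β be the normalized restriction of β̃ to W, i.e. β(S) = β̃(S ∩ W)/β̃(W). If ∫_W |ln h| dβ̃ < ∞, then KL(β ‖ α) = (1/β̃(W)) ∫_W ln h dβ̃ − ln β̃(W). -/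
open MeasureTheory Real

/-- For a σ-finite `α`, a probability measure `β̃ ≪ α` with density `h = dβ̃/dα`,
a measurable set `W` with `β̃(W) > 0`, and `β` the normalized restriction of `β̃` to `W`:
if `∫_W |ln h| dβ̃ < ∞` then `KL(β‖α) = (1/β̃(W)) ∫_W ln h dβ̃ − ln β̃(W)`. -/
theorem stmt5 {Ω : Type*} [MeasurableSpace Ω] (α βt : Measure Ω)
    [SigmaFinite α] [IsProbabilityMeasure βt] (hac : βt ≪ α)
    (W : Set Ω) (hW : MeasurableSet W) (hWpos : 0 < βt W)
    (hint : IntegrableOn (fun x => Real.log (βt.rnDeriv α x).toReal) W βt) :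
    klDiv ((βt W)⁻¹ • βt.restrict W) α
      = ((βt W).toReal)⁻¹ * (∫ x in W, Real.log (βt.rnDeriv α x).toReal ∂βt)
        - Real.log (βt W).toReal := by
  have hne : βt W ≠ 0 := hWpos.ne'
  have hfin : βt W ≠ ⊤ := measure_ne_top _ _
  have hr : 0 < (βt W).toReal := ENNReal.toReal_pos hne hfin
  have hinv : (βt W)⁻¹ ≠ ⊤ := ENNReal.inv_ne_top.mpr hne
  have h1 := Measure.rnDeriv_smul_left_of_ne_top (βt.restrict W) α hinv
  have h2 := Measure.rnDeriv_restrict βt α hW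
  have key : ∀ᵐ x ∂(βt.restrict W),
      Real.log (((βt W)⁻¹ • βt.restrict W).rnDeriv α x).toReal
        = Real.log (βt.rnDeriv α x).toReal - Real.log (βt W).toReal := by
    filter_upwards [ae_restrict_of_ae (hac.ae_le h1), ae_restrict_of_ae (hac.ae_le h2),
      ae_restrict_of_ae (Measure.rnDeriv_pos hac),
      ae_restrict_of_ae (hac.ae_le (Measure.rnDeriv_lt_top βt α)),
      ae_restrict_mem hW] with x hx1 hx2 hpos hlt hxW
    have hp : 0 < (βt.rnDeriv α x).toReal := ENNReal.toReal_pos hpos.ne' hlt.ne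
    rw [hx1, Pi.smul_apply, hx2, Set.indicator_of_mem hxW, smul_eq_mul, ENNReal.toReal_mul,
      ENNReal.toReal_inv, Real.log_mul (inv_ne_zero hr.ne') hp.ne', Real.log_inv]
    ring
  unfold klDiv
  rw [integral_smul_measure, integral_congr_ae key, integral_sub hint (integrable_const _),
    integral_const, ENNReal.toReal_inv, smul_eq_mul, smul_eq_mul, mul_sub]
  simp only [measureReal_def, Measure.restrict_apply_univ]
  rw [inv_mul_cancel_left₀ hr.ne']
end

section
/- Let m ≥ 1 and let α = α₁ ⊗ ⋯ ⊗ α_m be a product probability measure on ℝ^m, where each α_j has a density with respect to Lebesgue measure that is continuous at w*_j and strictly positive at w*_j, for some w* = (w*₁, …, w*_m) ∈ ℝ^m. Let f : ℝ^m → [0,∞) be measurable and suppose there exist r > 0 and k > 0 such that f(w) ≤ k·‖w − w*‖_∞ for all w with ‖w − w*‖_∞ ≤ r. Then for every γ ∈ (0,1) there exists C > 0 such that for every integer n ≥ 1 there is a probability measure β on ℝ^m with β ≪ α and ∫ f dβ + (1/n) KL(β ‖ α) ≤ C n^{−γ}. -/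
open MeasureTheory Real

lemma klDiv_cond_aux {Ω : Type*} [MeasurableSpace Ω] (α : Measure Ω) [IsProbabilityMeasure α]
    (B : Set Ω) (hB : MeasurableSet B) (h0 : α B ≠ 0) :
    klDiv (ProbabilityTheory.cond α B) α = - Real.log (α B).toReal := by
  have hp : IsProbabilityMeasure (ProbabilityTheory.cond α B) :=
    ProbabilityTheory.cond_isProbabilityMeasure h0
  have hac : ProbabilityTheory.cond α B ≪ α := ProbabilityTheory.cond_absolutelyContinuous
  have h1 : (ProbabilityTheory.cond α B).rnDeriv α =ᵐ[α]
      (α B)⁻¹ • (α.restrict B).rnDeriv α := by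
    unfold ProbabilityTheory.cond
    exact Measure.rnDeriv_smul_left_of_ne_top _ _ (ENNReal.inv_ne_top.2 h0)
  have h2 := Measure.rnDeriv_restrict_self α hB
  have h3 : ∀ᵐ x ∂(ProbabilityTheory.cond α B), x ∈ B := ProbabilityTheory.ae_cond_mem hB
  have h4 : (fun x => Real.log ((ProbabilityTheory.cond α B).rnDeriv α x).toReal)
      =ᵐ[ProbabilityTheory.cond α B] fun _ => - Real.log (α B).toReal := by
    filter_upwards [hac.ae_le h1, hac.ae_le h2, h3] with x a b c
    rw [a, Pi.smul_apply, b, Set.indicator_of_mem c]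
    simp [Real.log_inv]
  unfold klDiv
  rw [integral_congr_ae h4]
  simp

lemma density_ball_aux (g : ℝ → ℝ) (w c ρ δ : ℝ) (hδρ : δ ≤ ρ) (hc : 0 < c)
    (h : ∀ x, |x - w| ≤ ρ → c ≤ g x) :
    ENNReal.ofReal (c * (2 * δ)) ≤
      (volume.withDensity fun x => ENNReal.ofReal (g x)) (Metric.closedBall w δ) := by
  rw [withDensity_apply _ Metric.isClosed_closedBall.measurableSet, ENNReal.ofReal_mul hc.le,
    ← Real.volume_closedBall w, ← setLIntegral_const]
  refine setLIntegral_mono' Metric.isClosed_closedBall.measurableSet fun x hx => ?_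
  apply ENNReal.ofReal_le_ofReal
  apply h
  rw [Metric.mem_closedBall, Real.dist_eq] at hx
  linarith

lemma radius_aux (m : ℕ) (d : Fin m → ℝ → ℝ) (wstar : Fin m → ℝ)
    (hcont : ∀ j, ContinuousAt (d j) (wstar j))
    (hpos : ∀ j, 0 < d j (wstar j)) (r : ℝ) (hr : 0 < r) :
    ∃ c ρ : ℝ, 0 < c ∧ 0 < ρ ∧ ρ ≤ r ∧ ∀ j x, |x - wstar j| ≤ ρ → c ≤ d j x := by
  have h : ∀ᶠ ε in nhdsWithin (0:ℝ) (Set.Ioi 0), ∀ j, ∀ x, |x - wstar j| ≤ ε → ε ≤ d j x := by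
    rw [Filter.eventually_all]
    intro j
    have h1 : ∀ᶠ x in nhds (wstar j), d j (wstar j) / 2 < d j x :=
      (hcont j).eventually (lt_mem_nhds (half_lt_self (hpos j)))
    obtain ⟨e, he, h1⟩ := Metric.eventually_nhds_iff.1 h1
    have he' : 0 < min e (d j (wstar j) / 2) := lt_min he (half_pos (hpos j))
    filter_upwards [Ioo_mem_nhdsGT he'] with ε hε x hx
    have := h1 (y := x) (by rw [Real.dist_eq]; exact hx.trans_lt (hε.2.trans_le (min_le_left _ _)))
    exact ((hε.2.trans_le (min_le_right _ _)).trans this).le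
  obtain ⟨ε, h1, h2⟩ := (h.and (Ioo_mem_nhdsGT hr)).exists
  exact ⟨ε, ε, h2.1, h2.1, h2.2.le, h1⟩

/-- Convergence-rate corollary: let `α = ⊗ α_j` be a product probability measure on `ℝ^m`
whose factor densities `d_j` are continuous and positive at `w*_j`, and let `f ≥ 0` satisfy
`f(w) ≤ k‖w − w*‖_∞` on a sup-norm ball of radius `r` around `w*`.  Then for every
`γ ∈ (0,1)` there is `C > 0` such that for every `n ≥ 1` some probability measure `β ≪ α`
achieves `∫ f dβ + (1/n) KL(β‖α) ≤ C n^{−γ}`.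
(The norm on `Fin m → ℝ` is the sup norm.) -/
theorem stmt6 (m : ℕ) (hm : 1 ≤ m)
    (d : Fin m → ℝ → ℝ) (wstar : Fin m → ℝ)
    (hd_meas : ∀ j, Measurable (d j))
    (hα_prob : ∀ j,
      IsProbabilityMeasure (volume.withDensity fun x => ENNReal.ofReal (d j x)))
    (hcont : ∀ j, ContinuousAt (d j) (wstar j))
    (hpos : ∀ j, 0 < d j (wstar j))
    (f : (Fin m → ℝ) → ℝ) (hf_meas : Measurable f) (hf_nonneg : ∀ w, 0 ≤ f w)
    (r k : ℝ) (hr : 0 < r) (hk : 0 < k)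
    (hbound : ∀ w : Fin m → ℝ, ‖w - wstar‖ ≤ r → f w ≤ k * ‖w - wstar‖) :
    ∀ γ ∈ Set.Ioo (0 : ℝ) 1, ∃ C : ℝ, 0 < C ∧
      ∀ n : ℕ, 1 ≤ n →
        ∃ β : Measure (Fin m → ℝ), IsProbabilityMeasure β ∧
          β ≪ Measure.pi (fun j => volume.withDensity fun x => ENNReal.ofReal (d j x)) ∧
          (∫ w, f w ∂β) + (1 / (n : ℝ)) *
              klDiv β (Measure.pi fun j => volume.withDensity fun x => ENNReal.ofReal (d j x))
            ≤ C * (n : ℝ) ^ (-γ) := by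
  rintro γ ⟨hγ0, hγ1⟩
  obtain ⟨c, ρ, hc, hρ, hρr, hcd⟩ := radius_aux m d wstar hcont hpos r hr
  have hg : 0 < 1 - γ := by linarith
  refine ⟨k * ρ + m * |Real.log (c * (2 * ρ))| + m / (1 - γ), by positivity, ?_⟩
  intro n hn
  have hn1 : (1:ℝ) ≤ n := by exact_mod_cast hn
  have hn0 : (0:ℝ) < n := by linarith
  set α := Measure.pi (fun j => volume.withDensity fun x => ENNReal.ofReal (d j x)) with hα
  have hδ : 0 < ρ / n := by positivity
  have hδρ : ρ / n ≤ ρ := div_le_self hρ.le hn1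
  set B := Metric.closedBall wstar (ρ / n) with hBdef
  have hB : MeasurableSet B := Metric.isClosed_closedBall.measurableSet
  have hαB : ENNReal.ofReal ((c * (2 * (ρ / n))) ^ m) ≤ α B := by
    rw [hα, hBdef, closedBall_pi _ hδ.le, Measure.pi_pi, ENNReal.ofReal_pow (by positivity)]
    calc _ = ∏ j : Fin m, ENNReal.ofReal (c * (2 * (ρ / n))) := by simp
      _ ≤ _ := Finset.prod_le_prod' fun j _ => density_ball_aux _ _ c ρ _ hδρ hc (hcd j)
  have h0 : α B ≠ 0 := by
    refine (lt_of_lt_of_le ?_ hαB).ne'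
    rw [ENNReal.ofReal_pos]; positivity
  have hp : IsProbabilityMeasure (ProbabilityTheory.cond α B) :=
    ProbabilityTheory.cond_isProbabilityMeasure h0
  refine ⟨ProbabilityTheory.cond α B, hp, ProbabilityTheory.cond_absolutelyContinuous, ?_⟩
  have hI : ∫ w, f w ∂(ProbabilityTheory.cond α B) ≤ k * (ρ / n) := by
    have : ∫ w, f w ∂(ProbabilityTheory.cond α B) ≤
        ∫ w, k * (ρ / n) ∂(ProbabilityTheory.cond α B) := by
      refine integral_mono_of_nonneg (Filter.Eventually.of_forall hf_nonneg)
        (integrable_const _) ?_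
      filter_upwards [ProbabilityTheory.ae_cond_mem hB] with w hw
      rw [hBdef, Metric.mem_closedBall, dist_eq_norm] at hw
      exact (hbound w (by linarith)).trans (mul_le_mul_of_nonneg_left hw hk.le)
    simpa using this
  have hK : klDiv (ProbabilityTheory.cond α B) α ≤
      m * (|Real.log (c * (2 * ρ))| + Real.log n) := by
    rw [klDiv_cond_aux α B hB h0]
    have h1 : (c * (2 * (ρ / n))) ^ m ≤ (α B).toReal :=
      (ENNReal.ofReal_le_iff_le_toReal (measure_ne_top _ _)).1 hαB
    have h2 := Real.log_le_log (by positivity) h1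
    have h3 : c * (2 * (ρ / n)) = (c * (2 * ρ)) / n := by ring
    rw [Real.log_pow, h3, Real.log_div (by positivity) (by positivity)] at h2
    have h4 := neg_abs_le (Real.log (c * (2 * ρ)))
    have h5 : (m:ℝ) * (-|Real.log (c * (2 * ρ))|) ≤ m * Real.log (c * (2 * ρ)) :=
      mul_le_mul_of_nonneg_left h4 (by positivity)
    linarith
  have hlog : Real.log n ≤ (n:ℝ) ^ (1 - γ) / (1 - γ) := Real.log_le_rpow_div hn0.le hg
  have hpow : (n:ℝ) ^ (-γ) = (n:ℝ) ^ (1 - γ) / n := by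
    rw [show -γ = (1 - γ) - 1 by ring, Real.rpow_sub_one hn0.ne']
  have hone : (1:ℝ) ≤ (n:ℝ) ^ (1 - γ) := Real.one_le_rpow hn1 hg.le
  set P := (n:ℝ) ^ (1 - γ)
  set L := |Real.log (c * (2 * ρ))|
  have hL : 0 ≤ L := abs_nonneg _
  have hK2 : klDiv (ProbabilityTheory.cond α B) α ≤ m * (L * P + P / (1 - γ)) := by
    refine hK.trans (mul_le_mul_of_nonneg_left ?_ (by positivity))
    nlinarith
  have hI2 : k * ρ ≤ k * ρ * P := le_mul_of_one_le_right (by positivity) hone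
  rw [hpow]
  calc _ ≤ k * (ρ / n) + 1 / (n:ℝ) * (m * (L * P + P / (1 - γ))) := by gcongr
    _ = (k * ρ + m * (L * P + P / (1 - γ))) / n := by field_simp
    _ ≤ (k * ρ * P + m * (L * P + P / (1 - γ))) / n := by gcongr
    _ = _ := by ring
end
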